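/- Assume G is connected, G[supp μ] is not connected, and supp μ ≠ S. Let ε > 0 and let k be an integer with k ≥ ⌈1/ε⌉ and k > k̄. Then the time-homogeneous Markov chain X = (X(t) : t ∈ ℕ) with transition matrix P^{(μ_k,G)} and any initial distribution is consistent with G, and for every s ∈ S the limit lim_{t→∞} (1/t) Σ_{m=0}^{t−1} 1_{{X(m)=s}} exists almost surely and satisfies lim_{t→∞} | (1/t) Σ_{m=0}^{t−1} 1_{{X(m)=s}} − μ(s) | ≤ ε almost surely. -/

import Mathlib

open Finset Filter MeasureTheory

attribute [local instance] Classical.propDecidable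

/-- `k̄ = ⌈1 / min{μ(s) : s ∈ S, μ(s) > 0}⌉`. -/
noncomputable def suppMinCeil {N : ℕ} (μ : Fin N → ℝ) : ℕ :=
  ⌈1 / sInf (μ '' {s | 0 < μ s})⌉₊

/-- `A_k = {s ∈ S : μ(s) < 1/k}`. -/
noncomputable def Ak {N : ℕ} (μ : Fin N → ℝ) (k : ℕ) : Finset (Fin N) :=
  Finset.univ.filter fun s => μ s < 1 / (k : ℝ)

/-- `η_k`, the uniform distribution on `A_k`. -/
noncomputable def etak {N : ℕ} (μ : Fin N → ℝ) (k : ℕ) : Fin N → ℝ :=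
  fun s => if s ∈ Ak μ k then 1 / ((Ak μ k).card : ℝ) else 0

/-- `μ_k = (1/k) η_k + ((k-1)/k) μ`. -/
noncomputable def muk {N : ℕ} (μ : Fin N → ℝ) (k : ℕ) : Fin N → ℝ :=
  fun s => (1 / (k : ℝ)) * etak μ k s + (((k : ℝ) - 1) / k) * μ s

/-- The denominator appearing in the definition of the constant `p`:
`Σ_{m>l} 1_{{s^l,s^m} ∈ E} + Σ_{m<l} (ν(s^m)/ν(s^l)) 1_{{s^l,s^m} ∈ E}`. -/
noncomputable def denomP {V : Type*} [Fintype V] [LinearOrder V]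
    (G : SimpleGraph V) (ν : V → ℝ) (l : V) : ℝ :=
  (∑ m, if l < m ∧ G.Adj l m then (1 : ℝ) else 0)
    + ∑ m, if m < l ∧ G.Adj l m then ν m / ν l else 0

/-- The constant `p = min_l 1/(2 · denom(l))`. -/
noncomputable def pconst {V : Type*} [Fintype V] [LinearOrder V]
    (G : SimpleGraph V) (ν : V → ℝ) : ℝ :=
  ⨅ l, 1 / (2 * denomP G ν l)

/-- The transition matrix `P^{(ν,G)}`. -/
noncomputable def Pmat {V : Type*} [Fintype V] [LinearOrder V]
    (G : SimpleGraph V) (ν : V → ℝ) : Matrix V V ℝ :=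
  Matrix.of fun l m =>
    if l = m then 1 - pconst G ν * denomP G ν l
    else if l < m ∧ G.Adj l m then pconst G ν
    else if m < l ∧ G.Adj l m then (ν m / ν l) * pconst G ν
    else 0

/-- `X = (X(t) : t ∈ ℕ)` is a (possibly non-homogeneous) Markov chain with one-step
transition matrix `T t` at time `t` (and arbitrary initial distribution, namely the
law of `X 0`): the finite-dimensional distributions factorize as
`P(X_0 = x_0, …, X_{n+1} = x_{n+1}) = P(X_0 = x_0) ∏_{i=0}^{n} T i (x_i, x_{i+1})`. -/
def IsMarkovOn {Ω S : Type*} [MeasurableSpace Ω] (P : MeasureTheory.Measure Ω)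
    (X : ℕ → Ω → S) (T : ℕ → Matrix S S ℝ) : Prop :=
  ∀ (n : ℕ) (path : ℕ → S),
    (P {ω | ∀ i ≤ n + 1, X i ω = path i}).toReal
      = (P {ω | X 0 ω = path 0}).toReal
        * ∏ i ∈ Finset.range (n + 1), T i (path i) (path (i + 1))

/-- The process `X` is consistent with the graph `G`: with probability one,
`X(t)` and `X(t+1)` are adjacent in `G` (i.e. equal or joined by an edge). -/
def ConsistentWith {Ω V : Type*} [MeasurableSpace Ω] (P : MeasureTheory.Measure Ω)
    (X : ℕ → Ω → V) (G : SimpleGraph V) : Prop :=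
  ∀ t : ℕ, P {ω | X t ω = X (t + 1) ω ∨ G.Adj (X t ω) (X (t + 1) ω)} = 1

theorem denomP_pos {V : Type*} [Fintype V] [LinearOrder V] [Nontrivial V]
    {G : SimpleGraph V} (hG : G.Connected) {ν : V → ℝ} (hν : ∀ x, 0 < ν x) (l : V) :
    0 < denomP G ν l := by
  obtain ⟨m, hm⟩ := hG.preconnected.exists_adj_of_nontrivial l
  have h1 : ∀ m, 0 ≤ if l < m ∧ G.Adj l m then (1 : ℝ) else 0 := fun m => by
    split_ifs <;> simp
  have h2 : ∀ m, 0 ≤ if m < l ∧ G.Adj l m then ν m / ν l else 0 := fun m => by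
    split_ifs
    · exact (div_pos (hν m) (hν l)).le
    · exact le_rfl
  rcases lt_or_gt_of_ne hm.ne with h | h
  · refine add_pos_of_pos_of_nonneg ?_ (Finset.sum_nonneg fun m _ => h2 m)
    exact Finset.sum_pos' (fun m _ => h1 m) ⟨m, Finset.mem_univ m, by simp [h, hm]⟩
  · refine add_pos_of_nonneg_of_pos (Finset.sum_nonneg fun m _ => h1 m) ?_
    refine Finset.sum_pos' (fun m _ => h2 m) ⟨m, Finset.mem_univ m, ?_⟩
    rw [if_pos ⟨h, hm⟩]
    exact div_pos (hν m) (hν l)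

theorem pconst_pos {V : Type*} [Fintype V] [LinearOrder V] [Nontrivial V]
    {G : SimpleGraph V} (hG : G.Connected) {ν : V → ℝ} (hν : ∀ x, 0 < ν x) :
    0 < pconst G ν := by
  obtain ⟨l, hl⟩ := exists_eq_ciInf_of_finite (f := fun l => 1 / (2 * denomP G ν l))
  have := denomP_pos hG hν l
  rw [pconst, ← hl]
  positivity

theorem pconst_mul_denomP_le {V : Type*} [Fintype V] [LinearOrder V] [Nontrivial V]
    {G : SimpleGraph V} (hG : G.Connected) {ν : V → ℝ} (hν : ∀ x, 0 < ν x) (l : V) :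
    pconst G ν * denomP G ν l ≤ 1 / 2 := by
  have hd := denomP_pos hG hν l
  have : pconst G ν ≤ 1 / (2 * denomP G ν l) := ciInf_le (Set.finite_range _).bddBelow l
  calc pconst G ν * denomP G ν l ≤ 1 / (2 * denomP G ν l) * denomP G ν l := by gcongr
    _ = 1 / 2 := by field_simp

theorem Pmat_row_sum {V : Type*} [Fintype V] [LinearOrder V] (G : SimpleGraph V) (ν : V → ℝ)
    (l : V) : ∑ m, Pmat G ν l m = 1 := by
  have h : ∀ m, Pmat G ν l m = (if l = m then 1 - pconst G ν * denomP G ν l else 0)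
      + pconst G ν * ((if l < m ∧ G.Adj l m then (1 : ℝ) else 0)
        + (if m < l ∧ G.Adj l m then ν m / ν l else 0)) := fun m => by
    rw [Pmat, Matrix.of_apply]
    rcases lt_trichotomy l m with h | rfl | h
    · simp [h, h.ne, h.not_gt]
    · simp
    · simp [h, h.ne', h.not_gt, mul_comm]
  simp_rw [h, Finset.sum_add_distrib, ← Finset.mul_sum, Finset.sum_add_distrib]
  simp [denomP]

theorem Pmat_nonneg {V : Type*} [Fintype V] [LinearOrder V] [Nontrivial V]
    {G : SimpleGraph V} (hG : G.Connected) {ν : V → ℝ} (hν : ∀ x, 0 < ν x) (l m : V) :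
    0 ≤ Pmat G ν l m := by
  have hp := pconst_pos hG hν
  have hd := pconst_mul_denomP_le hG hν l
  have hl := hν l
  have hm := hν m
  rw [Pmat, Matrix.of_apply]
  split_ifs
  · linarith
  all_goals positivity

theorem Pmat_pos_of_adj {V : Type*} [Fintype V] [LinearOrder V] [Nontrivial V]
    {G : SimpleGraph V} (hG : G.Connected) {ν : V → ℝ} (hν : ∀ x, 0 < ν x) (l m : V)
    (h : G.Adj l m) : 0 < Pmat G ν l m := by
  have hp := pconst_pos hG hν
  have hl := hν l
  have hm := hν m
  rw [Pmat, Matrix.of_apply, if_neg h.ne]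
  rcases lt_or_gt_of_ne h.ne with h' | h'
  · simpa [h', h] using hp
  · rw [if_neg (by simp [h'.not_gt]), if_pos ⟨h', h⟩]
    positivity

theorem Pmat_eq_zero {V : Type*} [Fintype V] [LinearOrder V] {G : SimpleGraph V} {ν : V → ℝ}
    (l m : V) (h : ¬ (l = m ∨ G.Adj l m)) : Pmat G ν l m = 0 := by
  rw [not_or] at h
  simp [Pmat, h.1, h.2]

/-- Detailed balance. -/
theorem mul_Pmat_comm {V : Type*} [Fintype V] [LinearOrder V] {G : SimpleGraph V} {ν : V → ℝ}
    (hν : ∀ x, 0 < ν x) (l m : V) : ν l * Pmat G ν l m = ν m * Pmat G ν m l := by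
  have hl := (hν l).ne'
  have hm := (hν m).ne'
  simp only [Pmat, Matrix.of_apply, G.adj_comm m l]
  rcases lt_trichotomy l m with h | rfl | h
  · by_cases ha : G.Adj l m
    · simp only [h.ne, h.ne', h, h.not_gt, ha, if_true, if_false, and_true]
      field_simp
    · simp [h.ne, h.ne', ha]
  · rfl
  · by_cases ha : G.Adj l m
    · simp only [h.ne, h.ne', h, h.not_gt, ha, if_true, if_false, and_true]
      field_simp
    · simp [h.ne, h.ne', ha]

theorem Pmat_invariant {V : Type*} [Fintype V] [LinearOrder V] {G : SimpleGraph V} {ν : V → ℝ}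
    (hν : ∀ x, 0 < ν x) (m : V) : ∑ l, ν l * Pmat G ν l m = ν m := by
  simp_rw [mul_Pmat_comm hν _ m, ← Finset.mul_sum, Pmat_row_sum, mul_one]

theorem suppMinCeil_pos {N : ℕ} {μ : Fin N → ℝ} {s : Fin N} (hs : 0 < μ s) :
    0 < suppMinCeil μ := by
  have hfin : (μ '' {s | 0 < μ s}).Finite := Set.toFinite _
  have hne : (μ '' {s | 0 < μ s}).Nonempty := ⟨μ s, s, hs, rfl⟩
  obtain ⟨r, hr, he⟩ := hne.csInf_mem hfin
  rw [suppMinCeil, Nat.ceil_pos, ← he]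
  exact one_div_pos.2 hr

theorem sum_etak {N : ℕ} {μ : Fin N → ℝ} {k : ℕ} (h : (Ak μ k).Nonempty) :
    ∑ s, etak μ k s = 1 := by
  have : ((Ak μ k).card : ℝ) ≠ 0 := by exact_mod_cast h.card_pos.ne'
  simp only [etak, Finset.sum_ite_mem, Finset.univ_inter, Finset.sum_const, nsmul_eq_mul]
  field_simp

theorem etak_nonneg {N : ℕ} (μ : Fin N → ℝ) (k : ℕ) (s : Fin N) : 0 ≤ etak μ k s := by
  rw [etak]
  split_ifs <;> positivity

theorem etak_pos {N : ℕ} {μ : Fin N → ℝ} {k : ℕ} {s : Fin N} (hs : s ∈ Ak μ k) :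
    0 < etak μ k s := by
  have : 0 < (Ak μ k).card := Finset.card_pos.2 ⟨s, hs⟩
  rw [etak, if_pos hs]
  positivity

theorem sum_muk {N : ℕ} {μ : Fin N → ℝ} {k : ℕ} (hk : 0 < k) (h : (Ak μ k).Nonempty)
    (hμ1 : ∑ s, μ s = 1) : ∑ s, muk μ k s = 1 := by
  simp only [muk, Finset.sum_add_distrib, ← Finset.mul_sum, sum_etak h, hμ1]
  field_simp
  ring

theorem muk_pos {N : ℕ} {μ : Fin N → ℝ} (hμ0 : ∀ s, 0 ≤ μ s) {k : ℕ} (hk : 1 < k)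
    (s : Fin N) : 0 < muk μ k s := by
  have hk' : (0 : ℝ) < (k : ℝ) - 1 := by
    rw [sub_pos]
    exact_mod_cast hk
  have hk0 : (0 : ℝ) < k := by linarith
  have he := etak_nonneg μ k s
  rw [muk]
  rcases (hμ0 s).eq_or_lt with h | h
  · have := etak_pos (μ := μ) (k := k) (s := s) (by simp [Ak, ← h, hk0])
    rw [← h]
    positivity
  · positivity

theorem abs_muk_sub_le {N : ℕ} {μ : Fin N → ℝ} (hμ0 : ∀ s, 0 ≤ μ s) (hμ1 : ∑ s, μ s = 1)
    {k : ℕ} (hk : 0 < k) (h : (Ak μ k).Nonempty) (s : Fin N) :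
    |muk μ k s - μ s| ≤ 1 / k := by
  have hk0 : (0 : ℝ) < k := by exact_mod_cast hk
  have e1 : muk μ k s - μ s = 1 / k * (etak μ k s - μ s) := by
    rw [muk]
    field_simp
    ring
  have h1 := etak_nonneg μ k s
  have h2 : etak μ k s ≤ 1 := by
    rw [← sum_etak h]
    exact Finset.single_le_sum (fun i _ => etak_nonneg μ k i) (Finset.mem_univ s)
  have h3 : μ s ≤ 1 := by
    rw [← hμ1]
    exact Finset.single_le_sum (fun i _ => hμ0 i) (Finset.mem_univ s)
  rw [e1, abs_mul, abs_of_pos (by positivity : (0 : ℝ) < 1 / k)]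
  refine mul_le_of_le_one_right (by positivity) ?_
  rw [abs_le]
  constructor <;> linarith [hμ0 s]

theorem prob_cylinder {Ω S : Type*} [MeasurableSpace Ω] {P : Measure Ω}
    {X : ℕ → Ω → S} {T : Matrix S S ℝ} (hM : IsMarkovOn P X fun _ => T)
    (n : ℕ) (path : ℕ → S) :
    P.real {ω | ∀ i ≤ n, X i ω = path i}
      = P.real {ω | X 0 ω = path 0} * ∏ i ∈ Finset.range n, T (path i) (path (i + 1)) := by
  cases n with
  | zero => simp
  | succ n => exact hM n path

theorem prob_cylinder_succ {Ω S : Type*} [MeasurableSpace Ω] {P : Measure Ω}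
    {X : ℕ → Ω → S} {T : Matrix S S ℝ} (hM : IsMarkovOn P X fun _ => T)
    (t : ℕ) (a : Fin (t + 1) → S) (y : S) :
    P.real {ω | (fun i : Fin (t + 1) => X i ω) = a ∧ X (t + 1) ω = y}
      = P.real {ω | (fun i : Fin (t + 1) => X i ω) = a} * T (a (Fin.last t)) y := by
  let path : ℕ → S := fun i => if h : i < t + 1 then a ⟨i, h⟩ else y
  have hp : ∀ i (h : i < t + 1), path i = a ⟨i, h⟩ := fun i h => dif_pos h
  have hpy : path (t + 1) = y := dif_neg (by omega)
  have h1 : {ω | (fun i : Fin (t + 1) => X i ω) = a} = {ω | ∀ i ≤ t, X i ω = path i} := by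
    ext ω
    simp only [Set.mem_ofPred_eq, funext_iff]
    constructor
    · intro h i hi
      rw [hp i (by omega)]
      exact h ⟨i, by omega⟩
    · intro h i
      rw [h i (by omega), hp i i.2]
  have h2 : {ω | (fun i : Fin (t + 1) => X i ω) = a ∧ X (t + 1) ω = y}
      = {ω | ∀ i ≤ t + 1, X i ω = path i} := by
    ext ω
    have := Set.ext_iff.1 h1 ω
    simp only [Set.mem_ofPred_eq] at this ⊢
    rw [this, ← hpy]
    constructor
    · rintro ⟨h, h'⟩ i hi
      rcases Nat.lt_or_ge t i with hlt | hle
      · obtain rfl : i = t + 1 := by omega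
        exact h'
      · exact h i hle
    · exact fun h => ⟨fun i hi => h i (by omega), h _ le_rfl⟩
  rw [h1, h2, prob_cylinder hM, prob_cylinder hM, Finset.prod_range_succ, hpy,
    hp t (by omega), mul_assoc]
  rfl

/-- The one-step Markov property, in integrated form. -/
theorem integral_history_succ {Ω S : Type*} [MeasurableSpace Ω] [Fintype S] [MeasurableSpace S]
    [MeasurableSingletonClass S] {P : Measure Ω} [IsProbabilityMeasure P]
    {X : ℕ → Ω → S} (hX : ∀ t, Measurable (X t)) {T : Matrix S S ℝ}
    (hM : IsMarkovOn P X fun _ => T) (t : ℕ) (h : (Fin (t + 1) → S) → S → ℝ) :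
    ∫ ω, h (fun i : Fin (t + 1) => X i ω) (X (t + 1) ω) ∂P
      = ∑ a, P.real {ω | (fun i : Fin (t + 1) => X i ω) = a}
          * ∑ y, T (a (Fin.last t)) y * h a y := by
  have hZ : Measurable fun ω => ((fun i : Fin (t + 1) => X i ω), X (t + 1) ω) :=
    (measurable_pi_lambda _ fun i : Fin (t + 1) => hX i).prodMk (hX (t + 1))
  have hmap := integral_map (μ := P) hZ.aemeasurable
    (f := fun z : (Fin (t + 1) → S) × S => h z.1 z.2)
    (Measurable.aestronglyMeasurable (measurable_of_finite _))
  have : IsProbabilityMeasure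
      (P.map fun ω => ((fun i : Fin (t + 1) => X i ω), X (t + 1) ω)) :=
    Measure.isProbabilityMeasure_map hZ.aemeasurable
  rw [← hmap, integral_fintype Integrable.of_finite, Fintype.sum_prod_type]
  refine Finset.sum_congr rfl fun a _ => ?_
  rw [Finset.mul_sum]
  refine Finset.sum_congr rfl fun y _ => ?_
  rw [map_measureReal_apply hZ (measurableSet_singleton _), ← mul_assoc,
    ← prob_cylinder_succ hM, smul_eq_mul]
  congr 2
  ext ω
  simp [Prod.ext_iff]

/-- A function that is harmonic for an irreducible stochastic matrix is constant. -/
theorem harmonic_const {S : Type*} [Fintype S] {G : SimpleGraph S} (hG : G.Connected)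
    {T : Matrix S S ℝ} (hT0 : ∀ x y, 0 ≤ T x y) (hT1 : ∀ x, ∑ y, T x y = 1)
    (hTG : ∀ x y, G.Adj x y → 0 < T x y) {g : S → ℝ} (hg : ∀ x, ∑ y, T x y * g y = g x)
    (x y : S) : g x = g y := by
  have := hG.nonempty
  obtain ⟨z, hz⟩ := Finite.exists_max g
  suffices H : ∀ w, G.Reachable z w → g w = g z by
    rw [H x (hG.preconnected z x), H y (hG.preconnected z y)]
  rintro w ⟨p⟩
  induction p with
  | nil => rfl
  | @cons u v w huv p ih =>
    have h0 : ∑ y, T u y * (g u - g y) = 0 := by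
      simp_rw [mul_sub, Finset.sum_sub_distrib, ← Finset.sum_mul, hT1, hg]
      ring
    have h1 := (Finset.sum_eq_zero_iff_of_nonneg fun y _ =>
      mul_nonneg (hT0 u y) (sub_nonneg.2 (hz y))).1 h0 v (Finset.mem_univ v)
    have h2 : g u = g v := by
      rcases mul_eq_zero.1 h1 with h | h
      · exact absurd h (hTG u v huv).ne'
      · linarith
    rw [h2]
    exact ih fun y => h2 ▸ hz y

/-- Solvability of the Poisson equation for an irreducible stochastic matrix. -/
theorem exists_poisson_solution {S : Type*} [Fintype S] {G : SimpleGraph S} (hG : G.Connected)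
    {T : Matrix S S ℝ} (hT0 : ∀ x y, 0 ≤ T x y) (hT1 : ∀ x, ∑ y, T x y = 1)
    (hTG : ∀ x y, G.Adj x y → 0 < T x y) {ν : S → ℝ} (hν1 : ∑ x, ν x = 1)
    (hinv : ∀ y, ∑ x, ν x * T x y = ν y) {f : S → ℝ} (hf : ∑ x, ν x * f x = 0) :
    ∃ g : S → ℝ, ∀ x, g x - ∑ y, T x y * g y = f x := by
  let L : (S → ℝ) →ₗ[ℝ] (S → ℝ) := LinearMap.id - T.mulVecLin
  have hL : ∀ g x, L g x = g x - ∑ y, T x y * g y := fun g x => by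
    simp [L, Matrix.mulVec, dotProduct]
  let φ : (S → ℝ) →ₗ[ℝ] ℝ := Fintype.linearCombination ℝ ν
  have hφ : ∀ g, φ g = ∑ x, ν x * g x := fun g => by
    simp [φ, Fintype.linearCombination_apply, mul_comm]
  have hle : LinearMap.range L ≤ LinearMap.ker φ := by
    rintro _ ⟨g, rfl⟩
    rw [LinearMap.mem_ker, hφ]
    simp_rw [hL, mul_sub, Finset.sum_sub_distrib, Finset.mul_sum]
    rw [Finset.sum_comm, sub_eq_zero]
    refine Finset.sum_congr rfl fun y _ => ?_
    simp_rw [← mul_assoc, ← Finset.sum_mul, hinv]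
  have hker : Module.finrank ℝ (LinearMap.ker L) ≤ 1 := by
    have : LinearMap.ker L ≤ Submodule.span ℝ {fun _ => (1 : ℝ)} := by
      intro g hg
      have := hG.nonempty
      rw [Submodule.mem_span_singleton]
      refine ⟨g (Classical.arbitrary S), ?_⟩
      ext x
      have : ∀ x, ∑ y, T x y * g y = g x := fun x => by
        have := hL g x
        rw [LinearMap.mem_ker.1 hg, Pi.zero_apply] at this
        linarith
      simpa using harmonic_const hG hT0 hT1 hTG this _ x
    exact (Submodule.finrank_mono this).trans ((finrank_span_le_card _).trans (by simp))
  have hφ1 : LinearMap.range φ = ⊤ := by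
    rw [LinearMap.range_eq_top]
    intro c
    refine ⟨fun _ => c, ?_⟩
    rw [hφ, ← Finset.sum_mul, hν1, one_mul]
  have e1 := LinearMap.finrank_range_add_finrank_ker L
  have e2 := LinearMap.finrank_range_add_finrank_ker φ
  rw [hφ1, finrank_top, Module.finrank_self] at e2
  have heq := Submodule.eq_of_le_of_finrank_le hle (by omega)
  have : f ∈ LinearMap.range L := by
    rw [heq, LinearMap.mem_ker, hφ, hf]
  obtain ⟨g, hg⟩ := this
  exact ⟨g, fun x => by rw [← hL, hg]⟩

theorem integrable_comp_of_finite {Ω S : Type*} [MeasurableSpace Ω] [Finite S]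
    [MeasurableSpace S] [MeasurableSingletonClass S] {P : Measure Ω} [IsFiniteMeasure P]
    {Z : Ω → S} (hZ : Measurable Z) (f : S → ℝ) : Integrable (fun ω => f (Z ω)) P :=
  (Integrable.of_finite (μ := P.map Z) (f := f)).comp_measurable hZ

theorem ae_tendsto_zero_of_summable_integral {Ω : Type*} [MeasurableSpace Ω] {P : Measure Ω}
    {f : ℕ → Ω → ℝ} (hf0 : ∀ n ω, 0 ≤ f n ω) (hf : ∀ n, Integrable (f n) P)
    (hs : Summable fun n => ∫ ω, f n ω ∂P) :
    ∀ᵐ ω ∂P, Tendsto (fun n => f n ω) atTop (nhds 0) := by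
  have hm : ∀ n, AEMeasurable (fun ω => ENNReal.ofReal (f n ω)) P := fun n =>
    (hf n).aemeasurable.ennreal_ofReal
  have h : ∫⁻ ω, ∑' n, ENNReal.ofReal (f n ω) ∂P ≠ ⊤ := by
    rw [lintegral_tsum hm]
    simp_rw [← fun n => ofReal_integral_eq_lintegral_ofReal (hf n) (ae_of_all _ (hf0 n))]
    exact hs.tsum_ofReal_ne_top
  filter_upwards [ae_lt_top' (AEMeasurable.tsum hm) h] with ω hω
  have := ENNReal.tendsto_atTop_zero_of_tsum_ne_top hω.ne
  have := (ENNReal.tendsto_toReal ENNReal.zero_ne_top).comp this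
  simpa [Function.comp_def, ENNReal.toReal_ofReal (hf0 _ _)] using this

/-- Second moment bound for the martingale attached to a function of a Markov chain. -/
theorem integral_sq_martingale_le {Ω S : Type*} [MeasurableSpace Ω] [Fintype S]
    [MeasurableSpace S] [MeasurableSingletonClass S] {P : Measure Ω} [IsProbabilityMeasure P]
    {X : ℕ → Ω → S} (hX : ∀ t, Measurable (X t)) {T : Matrix S S ℝ}
    (hT1 : ∀ x, ∑ y, T x y = 1) (hM : IsMarkovOn P X fun _ => T) (g : S → ℝ) :
    ∃ C : ℝ, ∀ t : ℕ,
      Integrable (fun ω => (∑ m ∈ Finset.range t,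
        (g (X (m + 1) ω) - ∑ y, T (X m ω) y * g y)) ^ 2) P ∧
      ∫ ω, (∑ m ∈ Finset.range t, (g (X (m + 1) ω) - ∑ y, T (X m ω) y * g y)) ^ 2 ∂P
        ≤ C * t := by
  let d : S → S → ℝ := fun x y => g y - ∑ z, T x z * g z
  obtain ⟨C, hC⟩ := (Set.finite_range fun z : S × S => (d z.1 z.2) ^ 2).bddAbove
  have hd : ∀ x y, d x y ^ 2 ≤ C := fun x y => hC ⟨(x, y), rfl⟩
  have hd0 : ∀ x, ∑ y, T x y * d x y = 0 := fun x => by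
    simp_rw [d, mul_sub, Finset.sum_sub_distrib, ← Finset.sum_mul, hT1]
    ring
  let F : ∀ t : ℕ, (Fin (t + 1) → S) → ℝ := fun t a => ∑ m : Fin t, d (a m.castSucc) (a m.succ)
  have hF : ∀ t ω, F t (fun i => X i ω) = ∑ m ∈ Finset.range t, d (X m ω) (X (m + 1) ω) :=
    fun t ω => by simp [F, Finset.sum_range]
  have hY : ∀ t, Measurable fun ω => fun i : Fin (t + 1) => X i ω := fun t =>
    measurable_pi_lambda _ fun i => hX i
  have hZ : ∀ t, Measurable fun ω => (X t ω, X (t + 1) ω) := fun t => (hX t).prodMk (hX _)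
  have hI2 : ∀ t, Integrable (fun ω => F t (fun i => X i ω) ^ 2) P := fun t =>
    integrable_comp_of_finite (hY t) fun a => F t a ^ 2
  have hcross : ∀ t, ∫ ω, F t (fun i => X i ω) * d (X t ω) (X (t + 1) ω) ∂P = 0 := fun t => by
    have := integral_history_succ hX hM t fun a y => F t a * d (a (Fin.last t)) y
    simp_rw [mul_left_comm _ (F t _), ← Finset.mul_sum, hd0, mul_zero, Finset.sum_const_zero]
      at this
    simpa using this
  refine ⟨C, fun t => ?_⟩
  change Integrable (fun ω => (∑ m ∈ Finset.range t, d (X m ω) (X (m + 1) ω)) ^ 2) P ∧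
    ∫ ω, (∑ m ∈ Finset.range t, d (X m ω) (X (m + 1) ω)) ^ 2 ∂P ≤ C * t
  simp_rw [← hF]
  refine ⟨hI2 t, ?_⟩
  induction t with
  | zero => simp [F]
  | succ t ih =>
    have hstep : ∀ ω, F (t + 1) (fun i => X i ω) ^ 2 = F t (fun i => X i ω) ^ 2
        + (2 * (F t (fun i => X i ω) * d (X t ω) (X (t + 1) ω))
          + d (X t ω) (X (t + 1) ω) ^ 2) := fun ω => by
      rw [hF, hF, Finset.sum_range_succ]
      ring
    have i1 : Integrable (fun ω => F t (fun i => X i ω) * d (X t ω) (X (t + 1) ω)) P :=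
      integrable_comp_of_finite ((hY t).prodMk (hZ t))
        fun z : (Fin (t + 1) → S) × S × S => F t z.1 * d z.2.1 z.2.2
    have i2 : Integrable (fun ω => d (X t ω) (X (t + 1) ω) ^ 2) P :=
      integrable_comp_of_finite (hZ t) fun z : S × S => d z.1 z.2 ^ 2
    have i3 : ∫ ω, d (X t ω) (X (t + 1) ω) ^ 2 ∂P ≤ C := by
      calc _ ≤ ∫ _, C ∂P := integral_mono i2 (integrable_const _) fun ω => hd _ _
        _ = C := by simp
    simp_rw [hstep]
    have e1 := integral_add (hI2 t) ((i1.const_mul 2).add i2)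
    have e2 := integral_add (i1.const_mul 2) i2
    rw [integral_const_mul, hcross] at e2
    simp only [Pi.add_apply] at e1 e2
    rw [e1, e2]
    push_cast
    linarith

theorem eventually_succ_sq_le {a : ℝ} (ha : 1 < a) :
    ∀ᶠ n : ℕ in atTop, (((n + 1 + 1) ^ 2 : ℕ) : ℝ) ≤ a * ((n + 1) ^ 2 : ℕ) := by
  have h : Tendsto (fun n : ℕ => (1 + 1 / ((n : ℝ) + 1)) ^ 2) atTop (nhds 1) := by
    simpa using (tendsto_one_div_add_atTop_nhds_zero_nat.const_add (1 : ℝ)).pow 2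
  filter_upwards [h.eventually_le_const ha] with n hn
  have hn1 : (0 : ℝ) < (n : ℝ) + 1 := by positivity
  calc (((n + 1 + 1) ^ 2 : ℕ) : ℝ) = (1 + 1 / ((n : ℝ) + 1)) ^ 2 * ((n + 1) ^ 2 : ℕ) := by
        push_cast
        field_simp
    _ ≤ _ := by gcongr

/-- The ergodic theorem for irreducible Markov chains on a finite state space. -/
theorem ae_tendsto_occupation {Ω S : Type*} [MeasurableSpace Ω] [Fintype S]
    [MeasurableSpace S] [MeasurableSingletonClass S] {P : Measure Ω} [IsProbabilityMeasure P]
    {X : ℕ → Ω → S} (hX : ∀ t, Measurable (X t)) {G : SimpleGraph S} (hG : G.Connected)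
    {T : Matrix S S ℝ} (hT0 : ∀ x y, 0 ≤ T x y) (hT1 : ∀ x, ∑ y, T x y = 1)
    (hTG : ∀ x y, G.Adj x y → 0 < T x y) {ν : S → ℝ} (hν1 : ∑ x, ν x = 1)
    (hinv : ∀ y, ∑ x, ν x * T x y = ν y) (hM : IsMarkovOn P X fun _ => T) (s : S) :
    ∀ᵐ ω ∂P, Tendsto
      (fun t : ℕ => (∑ m ∈ Finset.range t, if X m ω = s then (1 : ℝ) else 0) / t)
      atTop (nhds (ν s)) := by
  obtain ⟨g, hg⟩ := exists_poisson_solution hG hT0 hT1 hTG hν1 hinv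
    (f := fun x => (if x = s then (1 : ℝ) else 0) - ν s) (by
      simp [mul_sub, Finset.sum_sub_distrib, ← Finset.sum_mul, hν1])
  obtain ⟨B, hB⟩ := (Set.finite_range fun x => |g x|).bddAbove
  have hgB : ∀ x, |g x| ≤ B := fun x => hB ⟨x, rfl⟩
  obtain ⟨C, hC⟩ := integral_sq_martingale_le hX hT1 hM g
  let M : ℕ → Ω → ℝ := fun t ω =>
    ∑ m ∈ Finset.range t, (g (X (m + 1) ω) - ∑ y, T (X m ω) y * g y)
  have hdecomp : ∀ t ω, (∑ m ∈ Finset.range t, if X m ω = s then (1 : ℝ) else 0)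
      = ν s * t + (g (X 0 ω) - g (X t ω)) + M t ω := fun t ω => by
    induction t with
    | zero => simp [M]
    | succ t ih =>
      have := hg (X t ω)
      simp only [M] at ih ⊢
      rw [Finset.sum_range_succ, ih, Finset.sum_range_succ]
      push_cast
      linarith
  have hsub := ae_tendsto_zero_of_summable_integral (P := P)
    (f := fun n ω => M ((n + 1) ^ 2) ω ^ 2 / (((n : ℝ) + 1) ^ 2) ^ 2)
    (fun n ω => by positivity) (fun n => (hC _).1.div_const _) (by
      refine Summable.of_nonneg_of_le (f := fun n : ℕ => C * (1 / ((n : ℝ) + 1) ^ 2))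
        (fun n => integral_nonneg fun ω => by positivity) (fun n => ?_) ?_
      · rw [integral_div, div_le_iff₀ (by positivity)]
        refine (hC _).2.trans_eq ?_
        push_cast
        field_simp
      · refine Summable.mul_left _ ?_
        have := (summable_nat_add_iff 1).2 (Real.summable_one_div_nat_pow.2 one_lt_two)
        simpa using this)
  have hsq : Tendsto (fun n : ℕ => (n + 1) ^ 2) atTop (atTop : Filter ℕ) :=
    tendsto_atTop_mono (fun n : ℕ => (by nlinarith : n ≤ (n + 1) ^ 2)) tendsto_id
  filter_upwards [hsub] with ω hω
  refine tendsto_div_of_monotone_of_exists_subseq_tendsto_div _ _ ?_ fun a ha =>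
    ⟨fun n => (n + 1) ^ 2, eventually_succ_sq_le ha, hsq, ?_⟩
  · refine monotone_nat_of_le_succ fun n => ?_
    rw [Finset.sum_range_succ]
    split_ifs <;> simp
  · have hM0 : Tendsto (fun n : ℕ => M ((n + 1) ^ 2) ω / ((n : ℝ) + 1) ^ 2) atTop (nhds 0) := by
      rw [tendsto_zero_iff_abs_tendsto_zero]
      simpa [← div_pow, Real.sqrt_sq_eq_abs, Function.comp_def] using hω.sqrt
    have hg0 : Tendsto (fun n : ℕ => (g (X 0 ω) - g (X ((n + 1) ^ 2) ω)) / ((n : ℝ) + 1) ^ 2)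
        atTop (nhds 0) := by
      have hb : Tendsto (fun n : ℕ => (2 * B) / (((n + 1) ^ 2 : ℕ) : ℝ)) atTop (nhds 0) :=
        tendsto_const_nhds.div_atTop (tendsto_natCast_atTop_atTop.comp hsq)
      refine squeeze_zero_norm (fun n => ?_) hb
      rw [Real.norm_eq_abs, abs_div, abs_of_pos (by positivity : (0 : ℝ) < ((n : ℝ) + 1) ^ 2)]
      push_cast
      gcongr
      have h1 := hgB (X 0 ω)
      have h2 := hgB (X ((n + 1) ^ 2) ω)
      have := abs_sub (g (X 0 ω)) (g (X ((n + 1) ^ 2) ω))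
      linarith
    have := (hg0.add hM0).const_add (ν s)
    rw [add_zero, add_zero] at this
    refine this.congr fun n => ?_
    rw [hdecomp]
    push_cast
    field_simp
    ring

theorem consistentWith_of_isMarkovOn {Ω S : Type*} [MeasurableSpace Ω] [Fintype S]
    [MeasurableSpace S] [MeasurableSingletonClass S] {P : Measure Ω} [IsProbabilityMeasure P]
    {X : ℕ → Ω → S} (hX : ∀ t, Measurable (X t)) {G : SimpleGraph S} {T : Matrix S S ℝ}
    (hT : ∀ x y, ¬ (x = y ∨ G.Adj x y) → T x y = 0) (hM : IsMarkovOn P X fun _ => T) :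
    ConsistentWith P X G := by
  intro t
  let h : S → S → ℝ := fun x y => if x = y ∨ G.Adj x y then 0 else 1
  have h0 : ∀ x y, 0 ≤ h x y := fun x y => by
    simp only [h]
    split_ifs <;> simp
  have hTh : ∀ x y, T x y * h x y = 0 := fun x y => by
    simp only [h]
    split_ifs with hxy
    · simp
    · simp [hT x y hxy]
  have hint := integral_history_succ hX hM t fun a y => h (a (Fin.last t)) y
  simp_rw [hTh, Finset.sum_const_zero, mul_zero, Finset.sum_const_zero] at hint
  have hi : Integrable (fun ω => h (X t ω) (X (t + 1) ω)) P :=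
    integrable_comp_of_finite ((hX t).prodMk (hX (t + 1))) fun z : S × S => h z.1 z.2
  have hae := (integral_eq_zero_iff_of_nonneg (fun ω => h0 _ _) hi).1 (by simpa using hint)
  have : ∀ᵐ ω ∂P, X t ω = X (t + 1) ω ∨ G.Adj (X t ω) (X (t + 1) ω) := by
    filter_upwards [hae] with ω hω
    by_contra hn
    simp [h, hn] at hω
  rw [measure_eq_measure_of_null_sdiff (Set.subset_univ _), measure_univ]
  rwa [← Set.compl_eq_univ_sdiff]

theorem stmt_15 {N : ℕ} (G : SimpleGraph (Fin N)) (hG : G.Connected)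
    (μ : Fin N → ℝ) (hμ0 : ∀ s, 0 ≤ μ s) (hμ1 : ∑ s, μ s = 1)
    (hord : ∀ l m : Fin N, l ≤ m → μ m ≤ μ l)
    (hsupp : ¬ (G.induce {s : Fin N | 0 < μ s}).Connected)
    (hne : {s : Fin N | 0 < μ s} ≠ Set.univ)
    (ε : ℝ) (hε : 0 < ε)
    (k : ℕ) (hk1 : ⌈1 / ε⌉₊ ≤ k) (hk2 : suppMinCeil μ < k)
    {Ω : Type*} [MeasurableSpace Ω] (P : Measure Ω) [IsProbabilityMeasure P]
    (X : ℕ → Ω → Fin N) (hX : ∀ t, Measurable (X t))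
    (hMarkov : IsMarkovOn P X fun _ => Pmat G (muk μ k)) :
    ConsistentWith P X G ∧
    ∀ s : Fin N, ∃ L : ℝ, |L - μ s| ≤ ε ∧
      ∀ᵐ ω ∂P,
        Tendsto (fun t : ℕ => (∑ m ∈ Finset.range t, if X m ω = s then (1 : ℝ) else 0) / t)
          atTop (nhds L) := by
  obtain ⟨z, hz⟩ : ∃ z, μ z = 0 := by
    obtain ⟨z, hz⟩ := (Set.ne_univ_iff_exists_notMem _).1 hne
    exact ⟨z, le_antisymm (not_lt.1 hz) (hμ0 z)⟩
  obtain ⟨w, hw⟩ : ∃ w, 0 < μ w := by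
    obtain ⟨w, -, hw⟩ := Finset.exists_lt_of_sum_lt (s := Finset.univ)
      (f := fun _ : Fin N => (0 : ℝ)) (g := μ) (by simp [hμ1])
    exact ⟨w, hw⟩
  have : Nontrivial (Fin N) := ⟨z, w, fun h => hw.ne' (h ▸ hz)⟩
  have hk : 0 < k := (Nat.zero_le _).trans_lt hk2
  have hk0 : (0 : ℝ) < k := by exact_mod_cast hk
  have hA : (Ak μ k).Nonempty := ⟨z, by simp [Ak, hz, hk]⟩
  have hkt : 1 < k := (Nat.succ_le_of_lt (suppMinCeil_pos hw)).trans_lt hk2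
  have hν := muk_pos hμ0 hkt
  refine ⟨consistentWith_of_isMarkovOn hX Pmat_eq_zero hMarkov, fun s => ⟨muk μ k s, ?_, ?_⟩⟩
  · refine (abs_muk_sub_le hμ0 hμ1 hk hA s).trans ?_
    rw [one_div_le hk0 hε]
    exact (Nat.le_ceil _).trans (by exact_mod_cast hk1)
  · convert ae_tendsto_occupation hX hG (Pmat_nonneg hG hν) (Pmat_row_sum G _)
      (Pmat_pos_of_adj hG hν) (sum_muk hk hA hμ1) (Pmat_invariant hν) hMarkov s
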